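/- Let A be a PCA with elementary sub-PCA A' and fixed pairing combinators, let X, Z ⊆ A, and write X×Z := {⟨x,z⟩ : x ∈ X, z ∈ Z}. Let f : X×Z → 𝒫*(A) and g : Z → 𝒫*(A), and define ∀_{π_Z}(f) : Z → 𝒫(A) by ∀_{π_Z}(f)(z) := ⋃_{x ∈ X} {⟨x,y⟩ : y ∈ f(⟨x,z⟩)}. Then the following are equivalent: (i) there exists ā ∈ A' such that for every z ∈ Z and every w ∈ ∀_{π_Z}(f)(z), ā·⟨z,w⟩ is defined and belongs to g(z); (ii) there exists b̄ ∈ A' such that for every x ∈ X, z ∈ Z and every y ∈ f(⟨x,z⟩), b̄·⟨⟨x,z⟩,y⟩ is defined and belongs to g(z). (The elementary Weihrauch doctrine has right adjoints along product projections: g ≤_dW ∀_{π_Z}(f) iff g ∘ π_Z ≤_dW f.) -/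

import Mathlib

universe u v

/-- A partial combinatory algebra together with an elementary sub-PCA (`sub`)
and fixed pairing combinators. Partiality is modeled via `Option`:
`app a b = some c` means "a·b is defined and equals c". -/
structure SubPCA (α : Type u) where
  app : α → α → Option α
  sub : Set α
  kComb : α
  sComb : α
  k_mem : kComb ∈ sub
  s_mem : sComb ∈ sub
  sub_closed : ∀ a b c : α, a ∈ sub → b ∈ sub → app a b = some c → c ∈ sub
  k_spec : ∀ a b : α, ∃ ka, app kComb a = some ka ∧ app ka b = some a
  s_spec₁ : ∀ a b : α, ∃ sa sab, app sComb a = some sa ∧ app sa b = some sab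
  s_spec₂ : ∀ a b c sa sab : α, app sComb a = some sa → app sa b = some sab →
    app sab c = (app a c).bind fun ac => (app b c).bind fun bc => app ac bc
  pair : α → α → α
  pair_inj : ∀ a b a' b' : α, pair a b = pair a' b' → a = a' ∧ b = b'
  pairComb : α
  pair_mem : pairComb ∈ sub
  pair_spec : ∀ a b : α, ∃ pa, app pairComb a = some pa ∧ app pa b = some (pair a b)
  fstComb : α
  sndComb : α
  fst_mem : fstComb ∈ sub
  snd_mem : sndComb ∈ sub
  fst_spec : ∀ a b : α, app fstComb (pair a b) = some a
  snd_spec : ∀ a b : α, app sndComb (pair a b) = some b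

/-- The Medvedev preorder on maps `X → 𝒫(A)`: `φ ≤_M ψ` iff there is `e ∈ A'`
such that for every `x` and every `b ∈ ψ x`, `e·b` is defined and `e·b ∈ φ x`. -/
def MedLE {α : Type u} (P : SubPCA α) {X : Type v} (φ ψ : X → Set α) : Prop :=
  ∃ e ∈ P.sub, ∀ x : X, ∀ b ∈ ψ x, ∃ c, P.app e b = some c ∧ c ∈ φ x

/-- The Muchnik preorder on maps `X → 𝒫(A)`: `φ ≤_w ψ` iff for every `x` and
every `b ∈ ψ x` there is `e ∈ A'` with `e·b` defined and in `φ x`. -/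
def MucLE {α : Type u} (P : SubPCA α) {X : Type v} (φ ψ : X → Set α) : Prop :=
  ∀ x : X, ∀ b ∈ ψ x, ∃ e ∈ P.sub, ∃ c, P.app e b = some c ∧ c ∈ φ x

/-- `∀_{π_Z}(f)(z) = ⋃_{x ∈ X} {⟨x,y⟩ : y ∈ f⟨x,z⟩}`. -/
def wForallProj {α : Type u} (P : SubPCA α) (X : Set α) (f : α → Set α) : α → Set α :=
  fun z => {w | ∃ x ∈ X, ∃ y ∈ f (P.pair x z), w = P.pair x y}

/-- A partial function is realized by an element of the sub-PCA. -/
def SubPCA.Realizable {α : Type u} (P : SubPCA α) (F : α → Option α) : Prop :=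
  ∃ e ∈ P.sub, ∀ a, P.app e a = F a

namespace SubPCA.Realizable

variable {α : Type u} {P : SubPCA α} {F G : α → Option α}

theorem of_mem {e : α} (he : e ∈ P.sub) : P.Realizable (P.app e) :=
  ⟨e, he, fun _ => rfl⟩

theorem const {c : α} (hc : c ∈ P.sub) : P.Realizable fun _ => some c := by
  obtain ⟨kc, hkc, -⟩ := P.k_spec c c
  refine ⟨kc, P.sub_closed _ _ _ P.k_mem hc hkc, fun a => ?_⟩
  obtain ⟨kc', hkc', h⟩ := P.k_spec c a
  obtain rfl : kc = kc' := Option.some.inj (hkc.symm.trans hkc')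
  exact h

theorem app (hF : P.Realizable F) (hG : P.Realizable G) :
    P.Realizable fun a => (F a).bind fun x => (G a).bind fun y => P.app x y := by
  obtain ⟨e, he, hF⟩ := hF
  obtain ⟨d, hd, hG⟩ := hG
  obtain ⟨se, sed, hse, hsed⟩ := P.s_spec₁ e d
  have hse_mem := P.sub_closed _ _ _ P.s_mem he hse
  refine ⟨sed, P.sub_closed _ _ _ hse_mem hd hsed, fun a => ?_⟩
  rw [P.s_spec₂ e d a se sed hse hsed, hF, hG]

theorem comp {e : α} (he : e ∈ P.sub) (hF : P.Realizable F) :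
    P.Realizable fun a => (F a).bind (P.app e) :=
  (const he).app hF

theorem pair (hF : P.Realizable F) (hG : P.Realizable G) :
    P.Realizable fun a => (F a).bind fun x => (G a).bind fun y => some (P.pair x y) := by
  obtain ⟨e, he, h⟩ := (comp P.pair_mem hF).app hG
  refine ⟨e, he, fun a => (h a).trans ?_⟩
  beta_reduce
  cases F a with
  | none => rfl
  | some x =>
    cases G a with
    | none =>
      obtain ⟨px, hpx, -⟩ := P.pair_spec x x
      simp [hpx]
    | some y =>
      obtain ⟨px, hpx, hpxy⟩ := P.pair_spec x y
      simp [hpx, hpxy]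

end SubPCA.Realizable

/-- The elementary Weihrauch doctrine has right adjoints along product
projections: `g ≤_dW ∀_{π_Z}(f) ↔ g ∘ π_Z ≤_dW f`. -/
theorem elementary_weihrauch_forall {α : Type u} (P : SubPCA α) (X Z : Set α)
    (f g : α → Set α)
    (hf : ∀ x ∈ X, ∀ z ∈ Z, (f (P.pair x z)).Nonempty)
    (hg : ∀ z ∈ Z, (g z).Nonempty) :
    (∃ ab ∈ P.sub, ∀ z ∈ Z, ∀ w ∈ wForallProj P X f z,
      ∃ r, P.app ab (P.pair z w) = some r ∧ r ∈ g z) ↔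
    (∃ bb ∈ P.sub, ∀ x ∈ X, ∀ z ∈ Z, ∀ y ∈ f (P.pair x z),
      ∃ r, P.app bb (P.pair (P.pair x z) y) = some r ∧ r ∈ g z) := by
  have hfst := SubPCA.Realizable.of_mem P.fst_mem
  have hsnd := SubPCA.Realizable.of_mem P.snd_mem
  constructor
  · rintro ⟨a, ha, h⟩
    obtain ⟨b, hb, hba⟩ := SubPCA.Realizable.comp ha
      ((SubPCA.Realizable.comp P.snd_mem hfst).pair
        ((SubPCA.Realizable.comp P.fst_mem hfst).pair hsnd))
    refine ⟨b, hb, fun x hx z hz y hy => ?_⟩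
    simpa [hba, P.fst_spec, P.snd_spec] using h z hz (P.pair x y) ⟨x, hx, y, hy, rfl⟩
  · rintro ⟨b, hb, h⟩
    obtain ⟨a, ha, hab⟩ := SubPCA.Realizable.comp hb
      (((SubPCA.Realizable.comp P.fst_mem hsnd).pair hfst).pair
        (SubPCA.Realizable.comp P.snd_mem hsnd))
    refine ⟨a, ha, ?_⟩
    rintro z hz _ ⟨x, hx, y, hy, rfl⟩
    simpa [hab, P.fst_spec, P.snd_spec] using h x hx z hz y hy
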